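/- arXiv:2310.10810 — 7 statements merged into one kernel-verified Lean document; each statement's English description precedes it below -/
import Mathlib

section
/- Let (S, d) be a finite metric space (the state space), A a set (the action space), and γ ∈ [0,1) a discount factor. Suppose r : S × A → ℝ satisfies |r(s,a) − r(s',a)| ≤ L_r · d(s,s') for all s, s' ∈ S and a ∈ A; suppose P : S × A → (S → ℝ) satisfies ∑_{s₁ ∈ S} |P(s₁ | s, a) − P(s₁ | s', a)| ≤ L_P · d(s,s') for all s, s' ∈ S and a ∈ A; suppose V : S → ℝ satisfies |V(s₁)| ≤ 1/(1−γ) for all s₁ ∈ S; and suppose Q : S × A → ℝ satisfies the Bellman relation Q(s,a) = r(s,a) + γ · ∑_{s₁ ∈ S} P(s₁ | s, a) · V(s₁) for all s, a. Then for all s, s' ∈ S and a ∈ A, |Q(s,a) − Q(s',a)| ≤ (L_r + γ·L_P/(1−γ)) · d(s,s'). -/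
/-- Theorem 1, part 1: in an `(L_r, L_P)`-smooth environment,
any Q-function satisfying the Bellman relation with a value function bounded by
`1/(1-γ)` is Lipschitz in the state with constant `L_r + γ·L_P/(1-γ)`. -/
theorem smooth_env_smooth_Q
    {S A : Type*} [Fintype S] [MetricSpace S]
    (γ Lr LP : ℝ) (hγ0 : 0 ≤ γ) (hγ1 : γ < 1)
    (r : S → A → ℝ) (P : S → A → S → ℝ) (V : S → ℝ) (Q : S → A → ℝ)
    (hr : ∀ s s' : S, ∀ a : A, |r s a - r s' a| ≤ Lr * dist s s')
    (hP : ∀ s s' : S, ∀ a : A, ∑ s₁, |P s a s₁ - P s' a s₁| ≤ LP * dist s s')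
    (hV : ∀ s₁ : S, |V s₁| ≤ 1 / (1 - γ))
    (hQ : ∀ s a, Q s a = r s a + γ * ∑ s₁, P s a s₁ * V s₁) :
    ∀ s s' : S, ∀ a : A,
      |Q s a - Q s' a| ≤ (Lr + γ * LP / (1 - γ)) * dist s s' := by
  intro s s' a
  have h0 : 0 < 1 - γ := by linarith
  have h1 : |∑ s₁, (P s a s₁ - P s' a s₁) * V s₁| ≤ LP * dist s s' * (1 / (1 - γ)) := by
    calc |∑ s₁, (P s a s₁ - P s' a s₁) * V s₁|
        ≤ ∑ s₁, |(P s a s₁ - P s' a s₁) * V s₁| := Finset.abs_sum_le_sum_abs _ _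
      _ ≤ ∑ s₁, |P s a s₁ - P s' a s₁| * (1 / (1 - γ)) := by
          refine Finset.sum_le_sum fun i _ => ?_
          rw [abs_mul]
          exact mul_le_mul_of_nonneg_left (hV i) (abs_nonneg _)
      _ = (∑ s₁, |P s a s₁ - P s' a s₁|) * (1 / (1 - γ)) := by rw [Finset.sum_mul]
      _ ≤ LP * dist s s' * (1 / (1 - γ)) :=
          mul_le_mul_of_nonneg_right (hP s s' a) (by positivity)
  have h2 : Q s a - Q s' a
      = (r s a - r s' a) + γ * ∑ s₁, (P s a s₁ - P s' a s₁) * V s₁ := by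
    rw [hQ, hQ]
    simp only [sub_mul, Finset.sum_sub_distrib]
    ring
  rw [h2]
  calc |(r s a - r s' a) + γ * ∑ s₁, (P s a s₁ - P s' a s₁) * V s₁|
      ≤ |r s a - r s' a| + |γ * ∑ s₁, (P s a s₁ - P s' a s₁) * V s₁| := abs_add_le _ _
    _ = |r s a - r s' a| + γ * |∑ s₁, (P s a s₁ - P s' a s₁) * V s₁| := by
        rw [abs_mul, abs_of_nonneg hγ0]
    _ ≤ Lr * dist s s' + γ * (LP * dist s s' * (1 / (1 - γ))) :=
        add_le_add (hr s s' a) (mul_le_mul_of_nonneg_left h1 hγ0)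
    _ = (Lr + γ * LP / (1 - γ)) * dist s s' := by ring
end

section
/- Let (S, d) be a metric space, A a finite set, and γ ∈ [0,1). Suppose Q : S × A → ℝ satisfies |Q(s,a)| ≤ 1/(1−γ) and |Q(s,a) − Q(s',a)| ≤ L_Q · d(s,s') for all s, s' ∈ S and a ∈ A. Suppose π : S → (A → ℝ) satisfies π(a|s) ≥ 0 and ∑_{a∈A} π(a|s) = 1 for every s, and ∑_{a∈A} |π(a|s) − π(a|s')| ≤ L_π · d(s,s') for all s, s'. Define V : S → ℝ by V(s) = ∑_{a∈A} Q(s,a) · π(a|s). Then for all s, s' ∈ S, |V(s) − V(s')| ≤ (L_π/(1−γ) + L_Q) · d(s,s'). -/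
/-- Theorem 1, part 2: the value function of an `L_π`-smooth
policy, with a bounded and coordinatewise `L_Q`-Lipschitz Q-function, is
Lipschitz with constant `L_π/(1-γ) + L_Q`. -/
theorem smooth_policy_smooth_V
    {S A : Type*} [MetricSpace S] [Fintype A]
    (γ LQ Lπ : ℝ) (hγ0 : 0 ≤ γ) (hγ1 : γ < 1)
    (Q : S → A → ℝ) (π : S → A → ℝ)
    (hQbd : ∀ s a, |Q s a| ≤ 1 / (1 - γ))
    (hQlip : ∀ s s' : S, ∀ a : A, |Q s a - Q s' a| ≤ LQ * dist s s')
    (hπ0 : ∀ s a, 0 ≤ π s a)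
    (hπ1 : ∀ s, ∑ a, π s a = 1)
    (hπlip : ∀ s s' : S, ∑ a, |π s a - π s' a| ≤ Lπ * dist s s')
    (V : S → ℝ) (hV : ∀ s, V s = ∑ a, Q s a * π s a) :
    ∀ s s' : S, |V s - V s'| ≤ (Lπ / (1 - γ) + LQ) * dist s s' := by
  intro s s'
  have hg : 0 ≤ 1 / (1 - γ) := by
    have : 0 < 1 - γ := by linarith
    positivity
  rw [hV, hV, ← Finset.sum_sub_distrib]
  calc |∑ a, (Q s a * π s a - Q s' a * π s' a)|
      ≤ ∑ a, |Q s a * π s a - Q s' a * π s' a| := Finset.abs_sum_le_sum_abs _ _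
    _ ≤ ∑ a, (1 / (1 - γ) * |π s a - π s' a| + LQ * dist s s' * π s' a) := by
        refine Finset.sum_le_sum fun a _ => ?_
        have e : Q s a * π s a - Q s' a * π s' a
            = Q s a * (π s a - π s' a) + (Q s a - Q s' a) * π s' a := by ring
        rw [e]
        refine (abs_add_le _ _).trans (add_le_add ?_ ?_)
        · rw [abs_mul]
          exact mul_le_mul_of_nonneg_right (hQbd s a) (abs_nonneg _)
        · rw [abs_mul, abs_of_nonneg (hπ0 s' a)]
          exact mul_le_mul_of_nonneg_right (hQlip s s' a) (hπ0 s' a)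
    _ = 1 / (1 - γ) * ∑ a, |π s a - π s' a| + LQ * dist s s' := by
        rw [Finset.sum_add_distrib, ← Finset.mul_sum, ← Finset.mul_sum, hπ1, mul_one]
    _ ≤ 1 / (1 - γ) * (Lπ * dist s s') + LQ * dist s s' := by
        have := mul_le_mul_of_nonneg_left (hπlip s s') hg
        linarith
    _ = (Lπ / (1 - γ) + LQ) * dist s s' := by ring
end

section
/- Let A be a finite nonempty set and define Softmax : (A → ℝ) → (A → ℝ) by Softmax(x)(a) = exp(x(a)) / ∑_{b∈A} exp(x(b)). Then Softmax is 1-Lipschitz from the ℓ1 norm to the ℓ1 norm: for all x, y : A → ℝ, ∑_{a∈A} |Softmax(x)(a) − Softmax(y)(a)| ≤ ∑_{a∈A} |x(a) − y(a)|. -/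
/-- The softmax operator on a finite nonempty set `A`. -/
noncomputable def softmax {A : Type*} [Fintype A] (x : A → ℝ) (a : A) : ℝ :=
  Real.exp (x a) / ∑ b, Real.exp (x b)

lemma softmax_aux_bound {A : Type*} [Fintype A] (s e d : A → ℝ)
    (hs : ∀ a, |s a| ≤ 1) (he : ∀ a, 0 < e a) (hZ : 0 < ∑ b, e b) :
    |((∑ a, s a * (e a * d a)) * (∑ b, e b) - (∑ a, s a * e a) * (∑ b, e b * d b))
      / (∑ b, e b) ^ 2| ≤ ∑ a, |d a| := by
  rw [abs_div, abs_of_pos (pow_pos hZ 2), div_le_iff₀ (pow_pos hZ 2)]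
  set Z := ∑ b, e b with hZdef
  have h1 : (∑ a, s a * (e a * d a)) * Z - (∑ a, s a * e a) * (∑ b, e b * d b)
      = ∑ a, d a * (e a * ∑ b, e b * (s a - s b)) := by
    have : ∀ a, ∑ b, e b * (s a - s b) = Z * s a - ∑ b, s b * e b := by
      intro a
      rw [hZdef, Finset.sum_mul, ← Finset.sum_sub_distrib]
      exact Finset.sum_congr rfl fun b _ => by ring
    simp only [this]
    rw [Finset.sum_mul, Finset.mul_sum, ← Finset.sum_sub_distrib]
    exact Finset.sum_congr rfl fun b _ => by ring
  rw [h1, Finset.sum_mul]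
  refine (Finset.abs_sum_le_sum_abs _ _).trans (Finset.sum_le_sum fun a _ => ?_)
  rw [abs_mul]
  refine mul_le_mul_of_nonneg_left ?_ (abs_nonneg _)
  rw [abs_mul, abs_of_pos (he a)]
  have hab : ∀ b, |s a - s b| ≤ 2 := fun b => by
    have := abs_sub (s a) (s b)
    linarith [hs a, hs b]
  have h2 : |∑ b, e b * (s a - s b)| ≤ ∑ b, e b * |s a - s b| :=
    (Finset.abs_sum_le_sum_abs _ _).trans_eq
      (Finset.sum_congr rfl fun b _ => by rw [abs_mul, abs_of_pos (he b)])
  have h3 : e a * (2 - |s a - s a|) ≤ ∑ b, e b * (2 - |s a - s b|) :=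
    Finset.single_le_sum (f := fun b => e b * (2 - |s a - s b|))
      (fun b _ => mul_nonneg (he b).le (by linarith [hab b])) (Finset.mem_univ a)
  have h4 : ∑ b, e b * (2 - |s a - s b|) = 2 * Z - ∑ b, e b * |s a - s b| := by
    rw [hZdef, Finset.mul_sum, ← Finset.sum_sub_distrib]
    exact Finset.sum_congr rfl fun b _ => by ring
  rw [h4, sub_self, abs_zero] at h3
  have h5 : |∑ b, e b * (s a - s b)| ≤ 2 * Z - 2 * e a := by linarith
  nlinarith [mul_le_mul_of_nonneg_left h5 (he a).le, sq_nonneg (Z - e a), sq_nonneg (e a)]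

/-- the softmax operator is 1-Lipschitz from the ℓ1 norm to the
ℓ1 norm. -/
theorem softmax_l1_lipschitz {A : Type*} [Fintype A] [Nonempty A] (x y : A → ℝ) :
    ∑ a, |softmax x a - softmax y a| ≤ ∑ a, |x a - y a| := by
  obtain ⟨s, hs, hs'⟩ : ∃ s : A → ℝ, (∀ a, |s a| ≤ 1) ∧
      ∀ a, |softmax x a - softmax y a| = s a * (softmax x a - softmax y a) := by
    refine ⟨fun a => if 0 ≤ softmax x a - softmax y a then 1 else -1, fun a => ?_, fun a => ?_⟩
    · dsimp only
      split_ifs <;> simp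
    · dsimp only
      split_ifs with h
      · rw [abs_of_nonneg h, one_mul]
      · rw [abs_of_neg (not_le.mp h)]; ring
  let e : ℝ → A → ℝ := fun t a => Real.exp (y a + t * (x a - y a))
  have he : ∀ t a, 0 < e t a := fun t a => Real.exp_pos _
  have hZ : ∀ t, 0 < ∑ b, e t b := fun t =>
    Finset.sum_pos (fun b _ => he t b) Finset.univ_nonempty
  have hd : ∀ a t, HasDerivAt (fun t => e t a) (e t a * (x a - y a)) t := by
    intro a t
    have := (((hasDerivAt_id t).mul_const (x a - y a)).const_add (y a)).exp
    simpa [e] using this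
  have hF : ∀ t, HasDerivAt (fun t => (∑ a, s a * e t a) / ∑ b, e t b)
      (((∑ a, s a * (e t a * (x a - y a))) * (∑ b, e t b)
        - (∑ a, s a * e t a) * (∑ b, e t b * (x b - y b))) / (∑ b, e t b) ^ 2) t := by
    intro t
    exact (HasDerivAt.fun_sum fun a _ => (hd a t).const_mul (s a)).div
      (HasDerivAt.fun_sum fun a _ => hd a t) (hZ t).ne'
  have key := norm_image_sub_le_of_norm_deriv_le_segment_01' (C := ∑ a, |x a - y a|)
    (fun t _ => (hF t).hasDerivWithinAt)
    (fun t _ => softmax_aux_bound s (e t) (fun a => x a - y a) hs (he t) (hZ t))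
  refine le_trans (le_of_eq ?_) ((le_abs_self _).trans key)
  simp only [hs']
  simp only [e, softmax, one_mul, zero_mul, add_zero, add_sub_cancel]
  rw [Finset.sum_div, Finset.sum_div, ← Finset.sum_sub_distrib]
  exact Finset.sum_congr rfl fun b _ => by ring
end

section
/- Let (S, d) be a metric space, A a finite nonempty set, η ≥ 0, and Q : S × A → ℝ with |Q(s,a) − Q(s',a)| ≤ L_Q · d(s,s') for all s, s' ∈ S and a ∈ A. Define the policy π_η(·|s) = Softmax(η·Q(s,·)). Then for all s, s' ∈ S, ∑_{a∈A} |π_η(a|s) − π_η(a|s')| ≤ η · |A| · L_Q · d(s,s'). -/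
lemma exp_logmean_aux (s : ℝ) (hs : 0 ≤ s) :
    2 * (Real.exp s - 1) ≤ s * (Real.exp s + 1) := by
  have hd : ∀ t : ℝ, HasDerivAt (fun s : ℝ => s * (Real.exp s + 1) - 2 * (Real.exp s - 1))
      (1 * (Real.exp t + 1) + t * Real.exp t - 2 * Real.exp t) t := by
    intro t
    exact ((hasDerivAt_id t).mul ((Real.hasDerivAt_exp t).add_const 1)).sub
      (((Real.hasDerivAt_exp t).sub_const 1).const_mul 2)
  have hm : Monotone (fun s : ℝ => s * (Real.exp s + 1) - 2 * (Real.exp s - 1)) := by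
    apply monotone_of_deriv_nonneg (fun t => (hd t).differentiableAt)
    intro t
    rw [(hd t).deriv]
    have h1 := Real.add_one_le_exp (-t)
    have h2 : Real.exp (-t) * Real.exp t = 1 := by rw [← Real.exp_add]; simp
    nlinarith [Real.exp_pos t]
  have := hm hs
  simp at this
  linarith

lemma exp_logmean_of_le (u v : ℝ) (h : v ≤ u) :
    Real.exp u - Real.exp v ≤ (u - v) * ((Real.exp u + Real.exp v) / 2) := by
  have h1 := exp_logmean_aux (u - v) (by linarith)
  have h2 : Real.exp u = Real.exp (u - v) * Real.exp v := by rw [← Real.exp_add]; simp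
  rw [h2]
  nlinarith [mul_le_mul_of_nonneg_right h1 (Real.exp_pos v).le]

lemma exp_logmean (u v : ℝ) :
    |Real.exp u - Real.exp v| ≤ |u - v| * ((Real.exp u + Real.exp v) / 2) := by
  rcases le_total v u with h | h
  · rw [abs_of_nonneg (sub_nonneg.2 (Real.exp_le_exp.2 h)), abs_of_nonneg (sub_nonneg.2 h)]
    exact exp_logmean_of_le u v h
  · rw [abs_sub_comm, abs_sub_comm u v, abs_of_nonneg (sub_nonneg.2 (Real.exp_le_exp.2 h)),
      abs_of_nonneg (sub_nonneg.2 h), add_comm (Real.exp u)]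
    exact exp_logmean_of_le v u h

lemma softmax_sum_one {A : Type*} [Fintype A] [Nonempty A] (x : A → ℝ) :
    ∑ a, softmax x a = 1 := by
  unfold softmax
  rw [← Finset.sum_div]
  exact div_self (Finset.sum_pos (fun b _ => Real.exp_pos _) Finset.univ_nonempty).ne'

lemma softmax_pair {A : Type*} [Fintype A] [Nonempty A] (x y : A → ℝ) (δ : ℝ)
    (h : ∀ a, |x a - y a| ≤ δ) (a b : A) :
    |softmax x a * softmax y b - softmax y a * softmax x b|
      ≤ δ * (softmax x a * softmax y b + softmax y a * softmax x b) := by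
  have hX : 0 < ∑ b, Real.exp (x b) :=
    Finset.sum_pos (fun b _ => Real.exp_pos _) Finset.univ_nonempty
  have hY : 0 < ∑ b, Real.exp (y b) :=
    Finset.sum_pos (fun b _ => Real.exp_pos _) Finset.univ_nonempty
  unfold softmax
  set X := ∑ b, Real.exp (x b)
  set Y := ∑ b, Real.exp (y b)
  have e1 : Real.exp (x a) / X * (Real.exp (y b) / Y) = Real.exp (x a + y b) / (X * Y) := by
    rw [Real.exp_add]; field_simp
  have e2 : Real.exp (y a) / Y * (Real.exp (x b) / X) = Real.exp (y a + x b) / (X * Y) := by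
    rw [Real.exp_add]; field_simp
  rw [e1, e2, ← sub_div, ← add_div, abs_div, abs_of_pos (mul_pos hX hY), ← mul_div_assoc]
  apply div_le_div_of_nonneg_right _ (mul_pos hX hY).le
  refine (exp_logmean _ _).trans ?_
  have hd : |x a + y b - (y a + x b)| ≤ 2 * δ := by
    have h1 := abs_le.1 (h a)
    have h2 := abs_le.1 (h b)
    rw [abs_le]; constructor <;> linarith
  have hp : 0 ≤ (Real.exp (x a + y b) + Real.exp (y a + x b)) / 2 := by positivity
  nlinarith [mul_le_mul_of_nonneg_right hd hp]

lemma softmax_l1 {A : Type*} [Fintype A] [Nonempty A] (x y : A → ℝ) (δ : ℝ)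
    (h : ∀ a, |x a - y a| ≤ δ) :
    ∑ a, |softmax x a - softmax y a| ≤ 2 * δ := by
  have hc : ∀ a, |softmax x a - softmax y a| ≤ δ * (softmax x a + softmax y a) := by
    intro a
    have e : ∀ c : ℝ, ∀ z : A → ℝ, c = ∑ b, c * softmax z b := by
      intro c z; rw [← Finset.mul_sum, softmax_sum_one, mul_one]
    calc |softmax x a - softmax y a|
        = |∑ b, (softmax x a * softmax y b - softmax y a * softmax x b)| := by
          rw [Finset.sum_sub_distrib, ← e, ← e]
      _ ≤ ∑ b, |softmax x a * softmax y b - softmax y a * softmax x b| :=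
          Finset.abs_sum_le_sum_abs _ _
      _ ≤ ∑ b, δ * (softmax x a * softmax y b + softmax y a * softmax x b) :=
          Finset.sum_le_sum fun b _ => softmax_pair x y δ h a b
      _ = δ * (softmax x a + softmax y a) := by
          rw [← Finset.mul_sum, Finset.sum_add_distrib, ← e, ← e]
  refine (Finset.sum_le_sum fun a _ => hc a).trans ?_
  rw [← Finset.mul_sum, Finset.sum_add_distrib, softmax_sum_one, softmax_sum_one]
  linarith

/-- the softmax policy `π_η(·|s) = Softmax(η·Q(s,·))` induced by
a coordinatewise `L_Q`-Lipschitz Q-function is ℓ1-Lipschitz in the state with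
constant `η·|A|·L_Q`. -/
theorem softmax_policy_lipschitz
    {S A : Type*} [MetricSpace S] [Fintype A] [Nonempty A]
    (η LQ : ℝ) (hη : 0 ≤ η)
    (Q : S → A → ℝ)
    (hQlip : ∀ s s' : S, ∀ a : A, |Q s a - Q s' a| ≤ LQ * dist s s') :
    ∀ s s' : S,
      ∑ a, |softmax (fun a' => η * Q s a') a - softmax (fun a' => η * Q s' a') a|
        ≤ η * (Fintype.card A : ℝ) * LQ * dist s s' := by
  intro s s'
  have hδ : ∀ a, |η * Q s a - η * Q s' a| ≤ η * (LQ * dist s s') := by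
    intro a
    rw [← mul_sub, abs_mul, abs_of_nonneg hη]
    exact mul_le_mul_of_nonneg_left (hQlip s s' a) hη
  have hδ0 : 0 ≤ η * (LQ * dist s s') := (abs_nonneg _).trans (hδ (Classical.arbitrary A))
  have hr : η * (Fintype.card A : ℝ) * LQ * dist s s'
      = (Fintype.card A : ℝ) * (η * (LQ * dist s s')) := by ring
  rw [hr]
  rcases subsingleton_or_nontrivial A with hA | hA
  · have h1 : ∀ (x : A → ℝ) (a : A), softmax x a = 1 := by
      intro x a
      have := softmax_sum_one x
      rwa [Fintype.sum_subsingleton _ a] at this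
    simp only [h1, sub_self, abs_zero, Finset.sum_const_zero]
    positivity
  · have hcard : (2 : ℝ) ≤ (Fintype.card A : ℝ) := by
      exact_mod_cast (Fintype.one_lt_card : 1 < Fintype.card A)
    exact (softmax_l1 _ _ _ hδ).trans (mul_le_mul_of_nonneg_right hcard hδ0)
end

section
/- Let γ ∈ [0,1), let P ∈ ℝ^{n×n} be a left stochastic matrix, and let (P̃_i)_{i∈ℕ} be a sequence of left stochastic matrices with ‖P̃_i − P‖₁ ≤ δ for all i, where ‖M‖₁ = max_j ∑_i |M_{i,j}| is the induced ℓ1 operator norm. Then ∑_{t=0}^{∞} γ^t · ‖P̃_{t−1}⋯P̃_0 − P^t‖₁ ≤ δ/(1−γ)² (the t = 0 term being 0, since the empty product is the identity). -/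
/-- The induced ℓ1 operator norm of a square matrix: the maximum absolute
column sum. -/
noncomputable def l1OpNorm {n : Type*} [Fintype n] [Nonempty n]
    (M : Matrix n n ℝ) : ℝ :=
  Finset.univ.sup' Finset.univ_nonempty (fun j => ∑ i, |M i j|)

/-- A square real matrix is left stochastic if all entries are nonnegative and
every column sums to 1. -/
def IsLeftStochastic {n : Type*} [Fintype n] (M : Matrix n n ℝ) : Prop :=
  (∀ i j, 0 ≤ M i j) ∧ ∀ j, ∑ i, M i j = 1

/-- The time-ordered product `M (t-1) * M (t-2) * ⋯ * M 0` (the empty product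
being the identity). -/
noncomputable def timeOrderedProd {n : Type*} [Fintype n] [DecidableEq n]
    (M : ℕ → Matrix n n ℝ) : ℕ → Matrix n n ℝ
  | 0 => 1
  | t + 1 => M t * timeOrderedProd M t

theorem l1aux_col_le {n : Type*} [Fintype n] [Nonempty n]
    (M : Matrix n n ℝ) (j : n) : ∑ i, |M i j| ≤ l1OpNorm M :=
  Finset.le_sup' (fun j => ∑ i, |M i j|) (Finset.mem_univ j)

theorem l1aux_le {n : Type*} [Fintype n] [Nonempty n]
    (M : Matrix n n ℝ) (c : ℝ) (h : ∀ j, ∑ i, |M i j| ≤ c) : l1OpNorm M ≤ c :=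
  Finset.sup'_le _ _ (fun j _ => h j)

theorem l1aux_nonneg {n : Type*} [Fintype n] [Nonempty n]
    (M : Matrix n n ℝ) : 0 ≤ l1OpNorm M :=
  (Finset.sum_nonneg (fun _ _ => abs_nonneg _)).trans
    (l1aux_col_le M (Classical.arbitrary n))

theorem l1aux_add {n : Type*} [Fintype n] [Nonempty n]
    (A B : Matrix n n ℝ) : l1OpNorm (A + B) ≤ l1OpNorm A + l1OpNorm B := by
  refine l1aux_le _ _ fun j => ?_
  calc ∑ i, |(A + B) i j| ≤ ∑ i, (|A i j| + |B i j|) :=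
        Finset.sum_le_sum fun i _ => abs_add_le _ _
    _ = ∑ i, |A i j| + ∑ i, |B i j| := Finset.sum_add_distrib
    _ ≤ _ := add_le_add (l1aux_col_le A j) (l1aux_col_le B j)

theorem l1aux_mul {n : Type*} [Fintype n] [Nonempty n]
    (A B : Matrix n n ℝ) : l1OpNorm (A * B) ≤ l1OpNorm A * l1OpNorm B := by
  refine l1aux_le _ _ fun j => ?_
  calc ∑ i, |(A * B) i j| ≤ ∑ i, ∑ k, |A i k| * |B k j| := by
        refine Finset.sum_le_sum fun i _ => ?_
        rw [Matrix.mul_apply]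
        refine (Finset.abs_sum_le_sum_abs _ _).trans_eq ?_
        simp only [abs_mul]
    _ = ∑ k, (∑ i, |A i k|) * |B k j| := by
        rw [Finset.sum_comm]
        simp only [Finset.sum_mul]
    _ ≤ ∑ k, l1OpNorm A * |B k j| := Finset.sum_le_sum fun k _ =>
        mul_le_mul_of_nonneg_right (l1aux_col_le A k) (abs_nonneg _)
    _ = l1OpNorm A * ∑ k, |B k j| := by rw [Finset.mul_sum]
    _ ≤ _ := mul_le_mul_of_nonneg_left (l1aux_col_le B j) (l1aux_nonneg A)

theorem l1aux_stoch {n : Type*} [Fintype n] [Nonempty n]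
    (A : Matrix n n ℝ) (hA : IsLeftStochastic A) : l1OpNorm A ≤ 1 := by
  refine l1aux_le _ _ fun j => ?_
  rw [← hA.2 j]
  exact Finset.sum_le_sum fun i _ => (abs_of_nonneg (hA.1 i j)).le

theorem l1aux_pow {n : Type*} [Fintype n] [DecidableEq n] [Nonempty n]
    (A : Matrix n n ℝ) (hA : IsLeftStochastic A) (t : ℕ) : l1OpNorm (A ^ t) ≤ 1 := by
  induction t with
  | zero =>
    refine l1aux_stoch _ ⟨fun i j => ?_, fun j => ?_⟩
    · rw [pow_zero, Matrix.one_apply]; split_ifs <;> norm_num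
    · simp [Matrix.one_apply]
  | succ t ih =>
    rw [pow_succ]
    exact (l1aux_mul _ _).trans
      (mul_le_one₀ ih (l1aux_nonneg _) (l1aux_stoch A hA))

theorem l1aux_step {n : Type*} [Fintype n] [DecidableEq n] [Nonempty n]
    (δ : ℝ) (P : Matrix n n ℝ) (Pt : ℕ → Matrix n n ℝ)
    (hP : IsLeftStochastic P) (hPt : ∀ i, IsLeftStochastic (Pt i))
    (hclose : ∀ i, l1OpNorm (Pt i - P) ≤ δ) (t : ℕ) :
    l1OpNorm (timeOrderedProd Pt t - P ^ t) ≤ t * δ := by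
  induction t with
  | zero =>
    refine l1aux_le _ _ fun j => ?_
    simp [timeOrderedProd]
  | succ t ih =>
    have e : timeOrderedProd Pt (t + 1) - P ^ (t + 1)
        = Pt t * (timeOrderedProd Pt t - P ^ t) + (Pt t - P) * P ^ t := by
      rw [timeOrderedProd, pow_succ']
      noncomm_ring
    rw [e]
    have h1 : l1OpNorm (Pt t * (timeOrderedProd Pt t - P ^ t)) ≤ t * δ :=
      (l1aux_mul _ _).trans ((mul_le_of_le_one_left (l1aux_nonneg _)
        (l1aux_stoch _ (hPt t))).trans ih)
    have h2 : l1OpNorm ((Pt t - P) * P ^ t) ≤ δ :=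
      (l1aux_mul _ _).trans ((mul_le_of_le_one_right (l1aux_nonneg _)
        (l1aux_pow P hP t)).trans (hclose t))
    have h3 := l1aux_add (Pt t * (timeOrderedProd Pt t - P ^ t)) ((Pt t - P) * P ^ t)
    push_cast
    linarith

/-- the discounted accumulation of the ℓ1 discrepancies of the
time-ordered products is at most `δ/(1-γ)²`. -/
theorem discounted_product_discrepancy
    {n : Type*} [Fintype n] [DecidableEq n] [Nonempty n]
    (γ δ : ℝ) (hγ0 : 0 ≤ γ) (hγ1 : γ < 1)
    (P : Matrix n n ℝ) (Pt : ℕ → Matrix n n ℝ)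
    (hP : IsLeftStochastic P) (hPt : ∀ i, IsLeftStochastic (Pt i))
    (hclose : ∀ i, l1OpNorm (Pt i - P) ≤ δ) :
    ∑' t : ℕ, γ ^ t * l1OpNorm (timeOrderedProd Pt t - P ^ t)
      ≤ δ / (1 - γ) ^ 2 := by
  have hδ : 0 ≤ δ := (l1aux_nonneg _).trans (hclose 0)
  have hs : HasSum (fun t : ℕ => (t : ℝ) * γ ^ t * δ) (γ / (1 - γ) ^ 2 * δ) :=
    (hasSum_coe_mul_geometric_of_norm_lt_one
      (by rwa [Real.norm_eq_abs, abs_of_nonneg hγ0])).mul_right δ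
  have hle : ∀ t : ℕ, γ ^ t * l1OpNorm (timeOrderedProd Pt t - P ^ t)
      ≤ (t : ℝ) * γ ^ t * δ := fun t => by
    have := mul_le_mul_of_nonneg_left (l1aux_step δ P Pt hP hPt hclose t) (pow_nonneg hγ0 t)
    linarith
  have hsum : Summable fun t : ℕ => γ ^ t * l1OpNorm (timeOrderedProd Pt t - P ^ t) :=
    Summable.of_nonneg_of_le
      (fun t => mul_nonneg (pow_nonneg hγ0 t) (l1aux_nonneg _)) hle hs.summable
  refine (hasSum_le hle hsum.hasSum hs).trans ?_
  rw [div_mul_eq_mul_div]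
  exact div_le_div_of_nonneg_right (mul_le_of_le_one_left hδ hγ1.le) (sq_nonneg _)
end

section
/- Let S and A be finite sets, γ ∈ [0,1), and L_π, ε ≥ 0. Let r : S × A → ℝ with |r(s,a)| ≤ 1, and let P : S × A → (S → ℝ) be a transition kernel (P(s'|s,a) ≥ 0 and ∑_{s'} P(s'|s,a) = 1). Let π : S → (A → ℝ) be a policy and (π̃_t)_{t∈ℕ} a sequence of policies with ∑_{a∈A} |π̃_t(a|s) − π(a|s)| ≤ L_π·ε for all t ∈ ℕ and s ∈ S. For a policy μ write P^μ(s', s) = ∑_a μ(a|s)·P(s'|s,a). Fix a starting state s̄ ∈ S and define the state distributions μ_t^π = (P^π)^t e(s̄) and μ_t^{π̃} = P^{π̃_{t−1}}⋯P^{π̃_0} e(s̄), where e(s̄) is the point mass at s̄. Define V^π(s̄) = ∑_{t=0}^{∞} γ^t ∑_{s,a} μ_t^π(s)·π(a|s)·r(s,a) and V^{π̃}(s̄) = ∑_{t=0}^{∞} γ^t ∑_{s,a} μ_t^{π̃}(s)·π̃_t(a|s)·r(s,a). Then |V^π(s̄) − V^{π̃}(s̄)| ≤ 2·L_π·ε/(1−γ)².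 -/
/-- The state-transition matrix induced by a policy `μ` and a transition kernel
`P`: entry `(s', s)` is `∑ a, μ s a * P s a s'`. -/
noncomputable def inducedKernel {S A : Type*} [Fintype S] [Fintype A]
    (P : S → A → S → ℝ) (μ : S → A → ℝ) : Matrix S S ℝ :=
  fun s' s => ∑ a, μ s a * P s a s'

open Finset in
lemma vr_step_nonneg {S A : Type*} [Fintype S] [Fintype A]
    (P : S → A → S → ℝ) (hP0 : ∀ s a s', 0 ≤ P s a s') (p : S → A → ℝ)
    (hp0 : ∀ s a, 0 ≤ p s a) (y : S → ℝ) (hy : ∀ s, 0 ≤ y s) (s' : S) :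
    0 ≤ ((inducedKernel P p).mulVec y) s' := by
  simp only [Matrix.mulVec, dotProduct, inducedKernel]
  exact sum_nonneg fun s _ => mul_nonneg
    (sum_nonneg fun a _ => mul_nonneg (hp0 s a) (hP0 s a s')) (hy s)

lemma vr_step_eq {S A : Type*} [Fintype S] [Fintype A]
    (P : S → A → S → ℝ) (p : S → A → ℝ) (y : S → ℝ) (s' : S) :
    ((inducedKernel P p).mulVec y) s' = ∑ s, ∑ a, (y s * p s a) * P s a s' := by
  simp only [Matrix.mulVec, dotProduct, inducedKernel, Finset.sum_mul]
  exact Finset.sum_congr rfl fun s _ => Finset.sum_congr rfl fun a _ => by ring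

lemma vr_swap {S A : Type*} [Fintype S] [Fintype A]
    (P : S → A → S → ℝ) (hP1 : ∀ s a, ∑ s', P s a s' = 1) (f : S → A → ℝ) :
    ∑ s', ∑ s, ∑ a, f s a * P s a s' = ∑ s, ∑ a, f s a := by
  rw [Finset.sum_comm]
  refine Finset.sum_congr rfl fun s _ => ?_
  rw [Finset.sum_comm]
  refine Finset.sum_congr rfl fun a _ => ?_
  rw [← Finset.mul_sum, hP1, mul_one]

lemma vr_step_sum {S A : Type*} [Fintype S] [Fintype A]
    (P : S → A → S → ℝ) (hP1 : ∀ s a, ∑ s', P s a s' = 1) (p : S → A → ℝ)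
    (hp1 : ∀ s, ∑ a, p s a = 1) (y : S → ℝ) :
    ∑ s', ((inducedKernel P p).mulVec y) s' = ∑ s, y s := by
  simp only [vr_step_eq]
  rw [vr_swap P hP1]
  simp only [← Finset.mul_sum, hp1, mul_one]

lemma vr_step_diff {S A : Type*} [Fintype S] [Fintype A]
    (P : S → A → S → ℝ) (hP0 : ∀ s a s', 0 ≤ P s a s')
    (hP1 : ∀ s a, ∑ s', P s a s' = 1) (p q : S → A → ℝ) (x y : S → ℝ) :
    ∑ s', |((inducedKernel P p).mulVec x) s' - ((inducedKernel P q).mulVec y) s'|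
      ≤ ∑ s, ∑ a, |x s * p s a - y s * q s a| := by
  rw [← vr_swap P hP1]
  refine Finset.sum_le_sum fun s' _ => ?_
  simp only [vr_step_eq, ← Finset.sum_sub_distrib]
  refine (Finset.abs_sum_le_sum_abs _ _).trans (Finset.sum_le_sum fun s _ => ?_)
  refine (Finset.abs_sum_le_sum_abs _ _).trans (Finset.sum_le_sum fun a _ => ?_)
  rw [← sub_mul, abs_mul, abs_of_nonneg (hP0 s a s')]

lemma vr_joint {S A : Type*} [Fintype S] [Fintype A] (c : ℝ)
    (p q : S → A → ℝ) (hp0 : ∀ s a, 0 ≤ p s a) (hp1 : ∀ s, ∑ a, p s a = 1)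
    (hc : ∀ s, ∑ a, |q s a - p s a| ≤ c) (x y : S → ℝ) (hy : ∀ s, 0 ≤ y s)
    (hy1 : ∑ s, y s = 1) :
    ∑ s, ∑ a, |x s * p s a - y s * q s a| ≤ ∑ s, |x s - y s| + c := by
  have h : ∀ s, ∑ a, |x s * p s a - y s * q s a| ≤ |x s - y s| + y s * c := by
    intro s
    calc ∑ a, |x s * p s a - y s * q s a|
        ≤ ∑ a, (|x s - y s| * p s a + y s * |q s a - p s a|) := by
          refine Finset.sum_le_sum fun a _ => ?_
          have e : x s * p s a - y s * q s a
              = (x s - y s) * p s a - y s * (q s a - p s a) := by ring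
          rw [e]
          refine (abs_sub _ _).trans ?_
          rw [abs_mul, abs_mul, abs_of_nonneg (hp0 s a), abs_of_nonneg (hy s)]
      _ = |x s - y s| + y s * ∑ a, |q s a - p s a| := by
          rw [Finset.sum_add_distrib, ← Finset.mul_sum, ← Finset.mul_sum, hp1, mul_one]
      _ ≤ _ := by
          have := mul_le_mul_of_nonneg_left (hc s) (hy s)
          linarith
  refine (Finset.sum_le_sum fun s _ => h s).trans ?_
  rw [Finset.sum_add_distrib, ← Finset.sum_mul, hy1, one_mul]

lemma vr_reward {S A : Type*} [Fintype S] [Fintype A]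
    (r : S → A → ℝ) (hr : ∀ s a, |r s a| ≤ 1) (f : S → A → ℝ) :
    |∑ s, ∑ a, f s a * r s a| ≤ ∑ s, ∑ a, |f s a| := by
  refine (Finset.abs_sum_le_sum_abs _ _).trans (Finset.sum_le_sum fun s _ => ?_)
  refine (Finset.abs_sum_le_sum_abs _ _).trans (Finset.sum_le_sum fun a _ => ?_)
  rw [abs_mul]
  exact mul_le_of_le_one_right (abs_nonneg _) (hr s a)

lemma vr_summable {S A : Type*} [Fintype S] [Fintype A] (γ : ℝ) (hγ0 : 0 ≤ γ)
    (hγ1 : γ < 1) (r : S → A → ℝ) (hr : ∀ s a, |r s a| ≤ 1)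
    (p : ℕ → S → A → ℝ) (hp0 : ∀ t s a, 0 ≤ p t s a) (hp1 : ∀ t s, ∑ a, p t s a = 1)
    (y : ℕ → S → ℝ) (hy : ∀ t s, 0 ≤ y t s) (hy1 : ∀ t, ∑ s, y t s = 1) :
    Summable fun t : ℕ => γ ^ t * ∑ s, ∑ a, y t s * p t s a * r s a := by
  refine Summable.of_norm_bounded (summable_geometric_of_lt_one hγ0 hγ1) fun t => ?_
  rw [Real.norm_eq_abs, abs_mul, abs_of_nonneg (pow_nonneg hγ0 t)]
  refine mul_le_of_le_one_right (pow_nonneg hγ0 t) ?_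
  refine (vr_reward r hr fun s a => y t s * p t s a).trans (le_of_eq ?_)
  simp only [abs_mul, abs_of_nonneg (hp0 t _ _), abs_of_nonneg (hy t _), ← Finset.mul_sum,
    hp1, mul_one, hy1]

/-- Theorem 3: the value of a stationary policy `π` and of a
non-stationary policy `π̃ = (π̃_t)` that is pointwise `L_π·ε`-close to `π` in ℓ1
distance over actions differ by at most `2·L_π·ε/(1-γ)²` at every starting
state. -/
theorem value_robustness_of_lipschitz_policy
    {S A : Type*} [Fintype S] [DecidableEq S] [Fintype A]
    (γ Lπ ε : ℝ) (hγ0 : 0 ≤ γ) (hγ1 : γ < 1)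
    (r : S → A → ℝ) (hr : ∀ s a, |r s a| ≤ 1)
    (P : S → A → S → ℝ)
    (hP0 : ∀ s a s', 0 ≤ P s a s') (hP1 : ∀ s a, ∑ s', P s a s' = 1)
    (π : S → A → ℝ) (πt : ℕ → S → A → ℝ)
    (hπ0 : ∀ s a, 0 ≤ π s a) (hπ1 : ∀ s, ∑ a, π s a = 1)
    (hπt0 : ∀ t s a, 0 ≤ πt t s a) (hπt1 : ∀ t s, ∑ a, πt t s a = 1)
    (hclose : ∀ t s, ∑ a, |πt t s a - π s a| ≤ Lπ * ε)
    (sbar : S) :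
    |(∑' t : ℕ, γ ^ t * ∑ s, ∑ a,
        ((inducedKernel P π ^ t).mulVec (fun s' => if s' = sbar then 1 else 0)) s
          * π s a * r s a)
      - ∑' t : ℕ, γ ^ t * ∑ s, ∑ a,
        ((timeOrderedProd (fun i => inducedKernel P (πt i)) t).mulVec
            (fun s' => if s' = sbar then 1 else 0)) s
          * πt t s a * r s a|
      ≤ 2 * Lπ * ε / (1 - γ) ^ 2 := by
  set e : S → ℝ := fun s' => if s' = sbar then 1 else 0 with he
  set x : ℕ → S → ℝ := fun t => (inducedKernel P π ^ t).mulVec e with hx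
  set y : ℕ → S → ℝ := fun t =>
    (timeOrderedProd (fun i => inducedKernel P (πt i)) t).mulVec e with hy
  have e0 : ∀ s, 0 ≤ e s := fun s => by simp only [he]; split_ifs <;> norm_num
  have e1 : ∑ s, e s = 1 := by simp [he]
  have x0 : x 0 = e := by simp [hx]
  have y0 : y 0 = e := by simp [hy, timeOrderedProd]
  have xs : ∀ t, x (t + 1) = (inducedKernel P π).mulVec (x t) := fun t => by
    simp only [hx, pow_succ', Matrix.mulVec_mulVec]
  have ys : ∀ t, y (t + 1) = (inducedKernel P (πt t)).mulVec (y t) := fun t => by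
    simp only [hy, timeOrderedProd, Matrix.mulVec_mulVec]
  have xn : ∀ t s, 0 ≤ x t s := by
    intro t
    induction t with
    | zero => rw [x0]; exact e0
    | succ t ih => rw [xs]; exact vr_step_nonneg P hP0 π hπ0 _ ih
  have yn : ∀ t s, 0 ≤ y t s := by
    intro t
    induction t with
    | zero => rw [y0]; exact e0
    | succ t ih => rw [ys]; exact vr_step_nonneg P hP0 (πt t) (hπt0 t) _ ih
  have x1 : ∀ t, ∑ s, x t s = 1 := by
    intro t
    induction t with
    | zero => rw [x0]; exact e1
    | succ t ih => rw [xs, vr_step_sum P hP1 π hπ1, ih]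
  have y1 : ∀ t, ∑ s, y t s = 1 := by
    intro t
    induction t with
    | zero => rw [y0]; exact e1
    | succ t ih => rw [ys, vr_step_sum P hP1 (πt t) (hπt1 t), ih]
  have hJ := fun t => vr_joint (Lπ * ε) π (πt t) hπ0 hπ1 (hclose t) (x t) (y t) (yn t) (y1 t)
  have hd : ∀ t : ℕ, ∑ s, |x t s - y t s| ≤ t * (Lπ * ε) := by
    intro t
    induction t with
    | zero => simp [x0, y0]
    | succ t ih =>
      rw [xs, ys]
      have h1 := vr_step_diff P hP0 hP1 π (πt t) (x t) (y t)
      have h2 := hJ t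
      push_cast
      linarith
  have hc : 0 ≤ Lπ * ε := (Finset.sum_nonneg fun a _ => abs_nonneg _).trans (hclose 0 sbar)
  have sx := vr_summable γ hγ0 hγ1 r hr (fun _ => π) (fun _ => hπ0) (fun _ => hπ1) x xn x1
  have sy := vr_summable γ hγ0 hγ1 r hr πt hπt0 hπt1 y yn y1
  have hγn : ‖γ‖ < 1 := by rw [Real.norm_eq_abs, abs_of_nonneg hγ0]; exact hγ1
  have hne : 1 - γ ≠ 0 := by linarith
  have hs : HasSum (fun t : ℕ => γ ^ t * (((t : ℝ) + 1) * (Lπ * ε)))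
      (Lπ * ε / (1 - γ) ^ 2) := by
    have h := ((hasSum_coe_mul_geometric_of_norm_lt_one hγn).add
      (hasSum_geometric_of_lt_one hγ0 hγ1)).mul_right (Lπ * ε)
    have e2 : (γ / (1 - γ) ^ 2 + (1 - γ)⁻¹) * (Lπ * ε) = Lπ * ε / (1 - γ) ^ 2 := by
      field_simp; ring
    rw [e2] at h
    have e3 : (fun t : ℕ => γ ^ t * (((t : ℝ) + 1) * (Lπ * ε)))
        = fun t : ℕ => ((t : ℝ) * γ ^ t + γ ^ t) * (Lπ * ε) := by
      funext t; ring
    rw [e3]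
    exact h
  have hb : ‖∑' t : ℕ, (γ ^ t * ∑ s, ∑ a, x t s * π s a * r s a
      - γ ^ t * ∑ s, ∑ a, y t s * πt t s a * r s a)‖ ≤ Lπ * ε / (1 - γ) ^ 2 := by
    refine tsum_of_norm_bounded hs fun t => ?_
    rw [← mul_sub, Real.norm_eq_abs, abs_mul, abs_of_nonneg (pow_nonneg hγ0 t)]
    refine mul_le_mul_of_nonneg_left ?_ (pow_nonneg hγ0 t)
    simp only [← Finset.sum_sub_distrib, ← sub_mul]
    have h1 := vr_reward r hr fun s a => x t s * π s a - y t s * πt t s a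
    have h2 := hJ t
    have h3 := hd t
    linarith
  rw [Summable.tsum_sub sx sy, Real.norm_eq_abs] at hb
  refine hb.trans ?_
  exact div_le_div_of_nonneg_right (by linarith) (sq_nonneg _)
end

section
/- Let A be a finite nonempty set, γ ∈ [0,1), and 0 < ε ≤ |A|. Let Q : A → ℝ satisfy |Q(a)| ≤ 1/(1−γ) for all a, and let π* : A → ℝ be a probability distribution supported on the maximizers of Q (π*(a) > 0 implies Q(a) = max_{a'} Q(a')). Set η = log(|A|/ε)/ε and define the softmax policy π_η(a) = exp(η·Q(a))/∑_{b∈A} exp(η·Q(b)). Then ∑_{a∈A} Q(a)·(π*(a) − π_η(a)) ≤ 3·ε/(1−γ). -/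
/-- at inverse temperature `η = log(|A|/ε)/ε`, the softmax of
a Q-function bounded by `1/(1-γ)` loses at most `3ε/(1-γ)` relative to any
distribution supported on the maximizers of `Q`. -/
theorem softmax_near_optimality
    {A : Type*} [Fintype A] [Nonempty A]
    (γ ε : ℝ) (hγ0 : 0 ≤ γ) (hγ1 : γ < 1)
    (hε : 0 < ε) (hεA : ε ≤ (Fintype.card A : ℝ))
    (Q πstar : A → ℝ)
    (hQbd : ∀ a, |Q a| ≤ 1 / (1 - γ))
    (hπstar0 : ∀ a, 0 ≤ πstar a) (hπstar1 : ∑ a, πstar a = 1)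
    (hsupp : ∀ a, 0 < πstar a → Q a = ⨆ a', Q a') :
    ∑ a, Q a *
        (πstar a
          - softmax (fun a' => (Real.log ((Fintype.card A : ℝ) / ε) / ε) * Q a') a)
      ≤ 3 * ε / (1 - γ) := by
  have hγ : 0 < 1 - γ := by linarith
  obtain ⟨a0, ha0⟩ := exists_eq_ciSup_of_finite (f := Q)
  have hle : ∀ a, Q a ≤ Q a0 := fun a => by
    rw [ha0]; exact le_ciSup (Set.finite_range Q).bddAbove a
  rw [← ha0] at hsupp
  have hN : (0 : ℝ) < Fintype.card A := lt_of_lt_of_le hε hεA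
  set N : ℝ := (Fintype.card A : ℝ) with hNdef
  set η : ℝ := Real.log (N / ε) / ε with hη
  have hη0 : 0 ≤ η := div_nonneg (Real.log_nonneg ((one_le_div hε).2 hεA)) hε.le
  have hηε : η * ε = Real.log (N / ε) := by rw [hη]; field_simp
  have hexp : Real.exp (-(η * ε)) = ε / N := by
    rw [hηε, Real.exp_neg, Real.exp_log (div_pos hN hε), inv_div]
  set p : A → ℝ := softmax (fun a' => η * Q a') with hp
  have hZ : 0 < ∑ b, Real.exp (η * Q b) :=
    Finset.sum_pos (fun b _ => Real.exp_pos _) Finset.univ_nonempty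
  have hp0 : ∀ a, 0 ≤ p a := fun a => div_nonneg (Real.exp_pos _).le hZ.le
  have hp1 : ∑ a, p a = 1 := by
    simp only [hp, softmax]
    rw [← Finset.sum_div, div_self hZ.ne']
  have hZ0 : Real.exp (η * Q a0) ≤ ∑ b, Real.exp (η * Q b) :=
    Finset.single_le_sum (f := fun b => Real.exp (η * Q b))
      (fun b _ => (Real.exp_pos _).le) (Finset.mem_univ a0)
  have hstar : ∑ a, Q a * πstar a = Q a0 := by
    have h : ∀ a, Q a * πstar a = Q a0 * πstar a := fun a => by
      rcases (hπstar0 a).eq_or_lt with h | h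
      · rw [← h]; simp
      · rw [hsupp a h]
    rw [Finset.sum_congr rfl (fun a _ => h a), ← Finset.mul_sum, hπstar1, mul_one]
  have hkey : ∀ a, p a * (Q a0 - Q a) ≤ ε * p a + 2 / (1 - γ) * (ε / N) := fun a => by
    have h2 : 0 ≤ 2 / (1 - γ) := by positivity
    have h3 : 0 ≤ ε / N := by positivity
    by_cases h : Q a0 - Q a ≤ ε
    · have := mul_le_mul_of_nonneg_left h (hp0 a)
      have := mul_nonneg h2 h3
      linarith
    · push Not at h
      have hpa : p a ≤ ε / N := by
        have : p a ≤ Real.exp (η * Q a) / Real.exp (η * Q a0) :=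
          div_le_div_of_nonneg_left (Real.exp_pos _).le (Real.exp_pos _) hZ0
        refine this.trans ?_
        rw [← Real.exp_sub, ← hexp]
        apply Real.exp_le_exp.2
        nlinarith
      have hgap : Q a0 - Q a ≤ 2 / (1 - γ) := by
        have e : 2 / (1 - γ) = 1 / (1 - γ) + 1 / (1 - γ) := by ring
        have := (abs_le.1 (hQbd a0)).2
        have := (abs_le.1 (hQbd a)).1
        linarith
      have h4 := mul_le_mul hpa hgap (hε.le.trans h.le) h3
      have := mul_nonneg hε.le (hp0 a)
      linarith
  have hsum : ∑ a, Q a * (πstar a - p a) = ∑ a, p a * (Q a0 - Q a) := by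
    have e1 : ∑ a, Q a * (πstar a - p a) = Q a0 - ∑ a, p a * Q a := by
      simp only [mul_sub, Finset.sum_sub_distrib, hstar, mul_comm]
    rw [e1]
    simp only [mul_sub, Finset.sum_sub_distrib]
    rw [← Finset.sum_mul, hp1, one_mul]
  rw [hsum]
  refine (Finset.sum_le_sum fun a _ => hkey a).trans ?_
  rw [Finset.sum_add_distrib, ← Finset.mul_sum, hp1, Finset.sum_const, Finset.card_univ,
    nsmul_eq_mul, ← hNdef]
  have e2 : N * (2 / (1 - γ) * (ε / N)) = 2 * ε / (1 - γ) := by field_simp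
  have e3 : ε ≤ ε / (1 - γ) := by
    rw [le_div_iff₀ hγ]; nlinarith
  have e4 : 3 * ε / (1 - γ) = ε / (1 - γ) + 2 * ε / (1 - γ) := by ring
  rw [e2, e4]
  linarith
end
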